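/- arXiv:2106.14673 — 2 statements merged into one kernel-verified Lean document; each statement's English description precedes it below -/
import Mathlib

section
/- Let B be an Erdős set and let (X_η, S) be the associated B-free subshift. Then every cellular automaton τ on (X_η, S) is given by a monotone code modulo a power of the shift: there exists t ∈ ℤ such that τ(x)(n) ≤ x(n+t) for all x ∈ X_η and all n ∈ ℤ (i.e., τ(x) ≤ S^t x coordinatewise). -/
open Filter Set

noncomputable section

/-- The shift by `t`: `(shiftPow t x) n = x (n + t)`, i.e. `S^t`. -/
def shiftPow (t : ℤ) (x : ℤ → Bool) : ℤ → Bool := fun n => x (n + t)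

/-- The left shift `S`, `(S x) n = x (n + 1)`. -/
def shift : (ℤ → Bool) → (ℤ → Bool) := shiftPow 1

/-- The support of a `0-1`-sequence. -/
def supp (x : ℤ → Bool) : Set ℤ := {n | x n = true}

/-- The all-zero sequence `0^ℤ`. -/
def zeroSeq : ℤ → Bool := fun _ => false

/-- The all-one sequence `1^ℤ`. -/
def oneSeq : ℤ → Bool := fun _ => true

/-- The sequence `u = 0^{-ℕ} 1 0^{ℕ}` with a single `1` at position `0`. -/
def uSeq : ℤ → Bool := fun n => if n = 0 then true else false

/-- The set `F_B ⊆ ℤ` of `B`-free integers. -/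
def BFreeSet (B : Set ℕ) : Set ℤ := {n | ∀ b ∈ B, ¬ ((b : ℤ) ∣ n)}

open Classical in
/-- `η`, the indicator function of the `B`-free integers. -/
noncomputable def eta (B : Set ℕ) : ℤ → Bool := fun n => if n ∈ BFreeSet B then true else false

/-- The `B`-free subshift `X_η`: the orbit closure of `η` under the shift. -/
def Xeta (B : Set ℕ) : Set (ℤ → Bool) := closure {x | ∃ t : ℤ, x = shiftPow t (eta B)}

/-- A set `A ⊆ ℤ` is `B`-admissible if for every `b ∈ B` some residue class
mod `b` is disjoint from `A`. -/
def IsBAdmissible (B : Set ℕ) (A : Set ℤ) : Prop :=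
  ∀ b ∈ B, ∃ r : ℤ, ∀ a ∈ A, ¬ ((b : ℤ) ∣ (a - r))

/-- The `B`-admissible subshift `X_B`. -/
def XB (B : Set ℕ) : Set (ℤ → Bool) := {x | IsBAdmissible B (supp x)}

/-- `B` is primitive: no element divides a different element. -/
def Primitive (B : Set ℕ) : Prop := ∀ a ∈ B, ∀ b ∈ B, a ∣ b → a = b

/-- `B` is an Erdős set: infinite, `1 ∉ B` (elements positive), primitive, pairwise
coprime and thin. -/
def IsErdos (B : Set ℕ) : Prop :=
  B.Infinite ∧ (∀ b ∈ B, 2 ≤ b) ∧ Primitive B ∧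
    (∀ a ∈ B, ∀ b ∈ B, a ≠ b → Nat.Coprime a b) ∧
    Summable (fun b : B => (1 : ℝ) / (b : ℝ))

/-- A cellular automaton on `X`: a continuous self-map of `X` commuting with the shift. -/
def IsCA (X : Set (ℤ → Bool)) (τ : (ℤ → Bool) → (ℤ → Bool)) : Prop :=
  Set.MapsTo τ X X ∧ ContinuousOn τ X ∧ ∀ x ∈ X, τ (shift x) = shift (τ x)

/-- Pre-injectivity of a CA on `X`. -/
def PreInjective (X : Set (ℤ → Bool)) (τ : (ℤ → Bool) → (ℤ → Bool)) : Prop :=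
  ∀ x ∈ X, ∀ y ∈ X, τ x = τ y → {n : ℤ | x n ≠ y n}.Finite → x = y

/-- `X` is hereditary. -/
def Hereditary (X : Set (ℤ → Bool)) : Prop :=
  ∀ x ∈ X, ∀ y : ℤ → Bool, (∀ n, y n ≤ x n) → y ∈ X

/-- The hereditary closure `X̃` of a set `X`. -/
def heredClosure (X : Set (ℤ → Bool)) : Set (ℤ → Bool) :=
  {y | ∃ x ∈ X, ∀ n, y n ≤ x n}

/-- `X` is a subshift: nonempty, closed and shift-invariant. -/
def IsSubshift (X : Set (ℤ → Bool)) : Prop :=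
  X.Nonempty ∧ IsClosed X ∧ shift '' X = X

/-- `τ` is given by a (sliding block) code of radius `ℓ` on `X`. -/
def HasRadius (X : Set (ℤ → Bool)) (τ : (ℤ → Bool) → (ℤ → Bool)) (ℓ : ℕ) : Prop :=
  ∀ x ∈ X, ∀ y ∈ X, ∀ n : ℤ,
    (∀ i : ℤ, n - ℓ ≤ i → i ≤ n + ℓ → x i = y i) → τ x n = τ y n

open Classical in
/-- `A ⊆ ℤ` has logarithmic density `d`. -/
noncomputable def HasLogDensity (A : Set ℤ) (d : ℝ) : Prop :=
  Tendsto (fun N : ℕ =>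
      (Real.log N)⁻¹ * ∑ n ∈ Finset.Icc 1 N, (if (n : ℤ) ∈ A then (1 : ℝ) / (n : ℝ) else 0))
    atTop (nhds d)

/-- `B` is taut: removing any `b ∈ B` strictly increases the logarithmic density of the
`B`-free integers. -/
def IsTaut (B : Set ℕ) : Prop :=
  ∀ b ∈ B, ∀ d d' : ℝ,
    HasLogDensity (BFreeSet B) d → HasLogDensity (BFreeSet (B \ {b})) d' → d < d'

/-- `x` and `y` are proximal: along some sequence `r k → ∞`, the shifted sequences
`S^{r k} x` and `S^{r k} y` agree on arbitrarily large central windows, i.e.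
`d(S^{r k} x, S^{r k} y) → 0` in the product topology. -/
def ProximalPair (x y : ℤ → Bool) : Prop :=
  ∃ r : ℕ → ℤ, Tendsto r atTop atTop ∧
    ∀ m : ℕ, ∀ᶠ k in atTop, ∀ n : ℤ, |n| ≤ (m : ℤ) →
      shiftPow (r k) x n = shiftPow (r k) y n

/-- A subshift is proximal if every pair of its points is proximal. -/
def IsProximalSubshift (X : Set (ℤ → Bool)) : Prop :=
  ∀ x ∈ X, ∀ y ∈ X, ProximalPair x y

end

lemma eta_eq_true_iff {B : Set ℕ} {n : ℤ} : eta B n = true ↔ ∀ b ∈ B, ¬ (b : ℤ) ∣ n := by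
  classical
  change (if n ∈ BFreeSet B then true else false) = true ↔ n ∈ BFreeSet B
  by_cases h : n ∈ BFreeSet B <;> simp [h]

/-- Every finite pattern of a point of `X_η` occurs in `η`. -/
lemma exists_shift_eta_eqOn {B : Set ℕ} {x : ℤ → Bool} (hx : x ∈ Xeta B) (F : Finset ℤ) :
    ∃ t : ℤ, ∀ n ∈ F, eta B (n + t) = x n := by
  have hopen : IsOpen ((F : Set ℤ).pi fun n => ({x n} : Set Bool)) :=
    isOpen_set_pi F.finite_toSet fun _ _ => isOpen_discrete _
  obtain ⟨y, hy, t, rfl⟩ := mem_closure_iff.1 hx _ hopen (by simp [Set.mem_pi])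
  exact ⟨t, fun n hn => by simpa [shiftPow] using hy n hn⟩

lemma shiftPow_eta_mem (B : Set ℕ) (t : ℤ) : shiftPow t (eta B) ∈ Xeta B :=
  subset_closure ⟨t, rfl⟩

/-- A continuous `Bool`-valued function on a compact set of sequences depends on a bounded
window only. -/
lemma exists_window {X : Set (ℤ → Bool)} (hX : IsCompact X) {f : (ℤ → Bool) → Bool}
    (hf : ContinuousOn f X) :
    ∃ l : ℕ, ∀ x ∈ X, ∀ y ∈ X, (∀ i : ℤ, -l ≤ i → i ≤ l → x i = y i) → f x = f y := by
  have hloc : ∀ x ∈ X, ∃ F : Finset ℤ, ∀ y ∈ X, (∀ i ∈ F, y i = x i) → f y = f x := by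
    intro x hx
    have h1 : {y | f y = f x} ∈ nhdsWithin x X :=
      hf x hx (isOpen_discrete {f x} |>.mem_nhds rfl)
    obtain ⟨U, hU, hxU, hUX⟩ := mem_nhdsWithin.1 h1
    obtain ⟨F, u, hu, hFU⟩ := isOpen_pi_iff.1 hU x hxU
    refine ⟨F, fun y hy hyF => hUX ⟨hFU fun i hi => ?_, hy⟩⟩
    rw [hyF i hi]
    exact (hu i hi).2
  choose! F hF using hloc
  obtain ⟨T, hTX, hT⟩ := hX.elim_nhds_subcover
    (fun x => (F x : Set ℤ).pi fun n => ({x n} : Set Bool)) fun x _ =>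
      (isOpen_set_pi (F x).finite_toSet fun _ _ => isOpen_discrete _).mem_nhds
        (by simp [Set.mem_pi])
  refine ⟨T.sup fun x => (F x).sup Int.natAbs, fun x hx y hy hxy => ?_⟩
  obtain ⟨z, hz, hxz⟩ := Set.mem_iUnion₂.1 (hT hx)
  have hxz' : ∀ i ∈ F z, x i = z i := fun i hi => hxz i hi
  rw [hF z (hTX z hz) x hx hxz', hF z (hTX z hz) y hy fun i hi => ?_]
  have h1 : i.natAbs ≤ T.sup fun x => (F x).sup Int.natAbs :=
    (Finset.le_sup (f := Int.natAbs) hi).trans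
      (Finset.le_sup (f := fun x => (F x).sup Int.natAbs) hz)
  rw [← hxz' i hi]
  exact (hxy i (by omega) (by omega)).symm

lemma card_filter_dvd_le {b M : ℕ} (hbM : b.Coprime M) (c T : ℕ) :
    (((Finset.range T).filter fun k => b ∣ c + M * k).card : ℝ) ≤ T / b + 1 := by
  have h1 : ((Finset.range T).filter fun k => b ∣ c + M * k).card ≤ T / b + 1 := by
    rw [← Finset.card_range (T / b + 1)]
    refine Finset.card_le_card_of_injOn (fun k => k / b) (fun k hk => ?_) ?_
    · simp only [Finset.coe_filter, Finset.mem_range, Set.mem_ofPred_eq] at hk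
      simpa using Nat.lt_succ_of_le (Nat.div_le_div_right hk.1.le)
    · intro k hk k' hk' h
      simp only [Finset.coe_filter, Finset.mem_range, Set.mem_ofPred_eq] at hk hk' h
      have h2 : c + M * k ≡ c + M * k' [MOD b] :=
        ((Nat.modEq_zero_iff_dvd.2 hk.2).trans (Nat.modEq_zero_iff_dvd.2 hk'.2).symm)
      have h3 : k % b = k' % b :=
        Nat.ModEq.cancel_left_of_coprime hbM (Nat.ModEq.add_left_cancel' c h2)
      rw [← Nat.div_add_mod k b, ← Nat.div_add_mod k' b, h, h3]
  calc _ ≤ ((T / b + 1 : ℕ) : ℝ) := by exact_mod_cast h1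
    _ ≤ T / b + 1 := by
      push_cast
      gcongr
      exact Nat.cast_div_le

lemma exists_tail_lt {B : Set ℕ} (hs : Summable fun b : B => (1 : ℝ) / (b : ℝ)) {ε : ℝ}
    (hε : 0 < ε) :
    ∃ K : ℕ, ∀ F : Finset ℕ, (∀ b ∈ F, b ∈ B ∧ K < b) → ∑ b ∈ F, (1 : ℝ) / b < ε := by
  have hs' : Summable (B.indicator fun b : ℕ => (1 : ℝ) / b) :=
    (summable_subtype_iff_indicator (f := fun b : ℕ => (1 : ℝ) / b)).1 hs
  obtain ⟨s, hs⟩ := summable_iff_vanishing_norm.1 hs' ε hε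
  refine ⟨s.sup id, fun F hF => ?_⟩
  have h1 : ∑ b ∈ F, (1 : ℝ) / b = ∑ b ∈ F, B.indicator (fun b : ℕ => (1 : ℝ) / b) b :=
    Finset.sum_congr rfl fun b hb =>
      (Set.indicator_of_mem (hF b hb).1 fun b : ℕ => (1 : ℝ) / b).symm
  rw [h1]
  refine (le_abs_self _).trans_lt (hs F ?_)
  rw [Finset.disjoint_left]
  intro b hb hbs
  exact absurd (Finset.le_sup (f := id) hbs) (not_le.2 (hF b hb).2)

/-- Sieving a progression by the large elements of a thin set coprime to the difference: some
window of given length avoids all their multiples. -/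
lemma exists_window_not_dvd {B : Set ℕ} (hs : Summable fun b : B => (1 : ℝ) / (b : ℝ))
    (L : ℕ) (hL : 0 < L) :
    ∃ K : ℕ, ∀ M s : ℕ, 0 < s → ∃ k : ℕ, ∀ b ∈ B, K < b → b.Coprime M →
      ∀ j < L, ¬ b ∣ (s + j) + M * k := by
  classical
  obtain ⟨K, hK⟩ := exists_tail_lt hs (ε := 1 / (4 * L)) (by positivity)
  refine ⟨K, fun M s hs0 => ?_⟩
  obtain ⟨K', hK'⟩ := exists_tail_lt hs (ε := 1 / (4 * L * (s + M + L))) (by positivity)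
  set T := K' + 1 with hT
  by_contra! hcon
  set N := s + M * T + L
  set Q := (Finset.Ioc K N).filter fun b => b ∈ B ∧ b.Coprime M
  have hcover : Finset.range T ⊆ Q.biUnion fun b => (Finset.range L).biUnion fun j =>
      (Finset.range T).filter fun k => b ∣ (s + j) + M * k := by
    intro k hk
    obtain ⟨b, hbB, hKb, hbM, j, hj, hd⟩ := hcon k
    have hk' := Finset.mem_range.1 hk
    have h1 : b ≤ (s + j) + M * k := Nat.le_of_dvd (by omega) hd
    have h2 : M * k ≤ M * T := Nat.mul_le_mul_left _ hk'.le
    simp only [Finset.mem_biUnion, Finset.mem_filter, Q, Finset.mem_Ioc]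
    exact ⟨b, ⟨⟨hKb, by omega⟩, hbB, hbM⟩, j, Finset.mem_range.2 hj, hk, hd⟩
  have hTpos : (0 : ℝ) < T := by positivity
  have hLpos : (0 : ℝ) < L := by exact_mod_cast hL
  have hcard : (T : ℝ) ≤ ∑ b ∈ Q, L * ((T : ℝ) / b + 1) := by
    calc (T : ℝ) = ((Finset.range T).card : ℝ) := by simp
      _ ≤ ((∑ b ∈ Q, ∑ j ∈ Finset.range L,
          ((Finset.range T).filter fun k => b ∣ (s + j) + M * k).card : ℕ) : ℝ) := by
        exact_mod_cast (Finset.card_le_card hcover).trans (Finset.card_biUnion_le.trans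
          (Finset.sum_le_sum fun b _ => Finset.card_biUnion_le))
      _ ≤ ∑ b ∈ Q, ∑ j ∈ Finset.range L, ((T : ℝ) / b + 1) := by
        push_cast
        refine Finset.sum_le_sum fun b hb => Finset.sum_le_sum fun j _ => ?_
        simp only [Q, Finset.mem_filter, Finset.mem_Ioc] at hb
        exact card_filter_dvd_le hb.2.2 _ _
      _ = _ := by simp only [Finset.sum_const, Finset.card_range, nsmul_eq_mul]
  have hbound : ∀ b ∈ Q, (T : ℝ) / b + 1 ≤
      2 * T * (1 / b) + if T ≤ b then (N : ℝ) * (1 / b) else 0 := by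
    intro b hb
    simp only [Q, Finset.mem_filter, Finset.mem_Ioc] at hb
    have hb0 : (0 : ℝ) < b := by exact_mod_cast (by omega : 0 < b)
    have hTb : (T : ℝ) / b = T * (1 / b) := by ring
    have hTb0 : 0 ≤ (T : ℝ) / b := by positivity
    split_ifs with h
    · have : 1 ≤ (N : ℝ) * (1 / b) := by
        rw [mul_one_div, one_le_div hb0]
        exact_mod_cast hb.1.2
      linarith
    · have : 1 ≤ (T : ℝ) / b := by
        rw [one_le_div hb0]
        exact_mod_cast (not_le.1 h).le
      linarith
  have htail1 := hK Q fun b hb => by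
    simp only [Q, Finset.mem_filter, Finset.mem_Ioc] at hb
    exact ⟨hb.2.1, hb.1.1⟩
  have htail2 := hK' (Q.filter fun b => T ≤ b) fun b hb => by
    simp only [Q, Finset.mem_filter, Finset.mem_Ioc] at hb
    exact ⟨hb.1.2.1, by omega⟩
  have hN : (N : ℝ) ≤ (s + M + L) * T := by
    have h1 : (1 : ℝ) ≤ T := by exact_mod_cast (by omega : 1 ≤ T)
    have h2 : (s : ℝ) * 1 ≤ s * T := by gcongr
    have h3 : (L : ℝ) * 1 ≤ L * T := by gcongr
    simp only [N]
    push_cast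
    nlinarith
  have hsum : ∑ b ∈ Q, L * ((T : ℝ) / b + 1) ≤ L * (2 * T * ∑ b ∈ Q, (1 : ℝ) / b +
      N * ∑ b ∈ Q.filter (fun b => T ≤ b), (1 : ℝ) / b) := by
    rw [← Finset.mul_sum, Finset.mul_sum _ _ (2 * (T : ℝ)), Finset.mul_sum _ _ (N : ℝ),
      Finset.sum_filter (fun b => T ≤ b), ← Finset.sum_add_distrib]
    exact mul_le_mul_of_nonneg_left (Finset.sum_le_sum hbound) hLpos.le
  have h1 : L * (2 * T * ∑ b ∈ Q, (1 : ℝ) / b) ≤ L * (2 * T * (1 / (4 * L))) := by gcongr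
  have h2 : L * (N * ∑ b ∈ Q.filter (fun b => T ≤ b), (1 : ℝ) / b) ≤
      L * ((s + M + L) * T * (1 / (4 * L * (s + M + L)))) := by gcongr
  have h3 : L * (2 * T * (1 / (4 * (L : ℝ)))) = T / 2 := by field_simp; norm_num
  have h4 : L * ((s + M + L) * T * (1 / (4 * (L : ℝ) * (s + M + L)))) = T / 4 := by
    field_simp
  linarith

/-- Chinese remainder theorem for finitely many pairwise coprime moduli, integer targets. -/
lemma exists_pos_forall_dvd_sub {Q : Finset ℕ} (hpos : ∀ q ∈ Q, q ≠ 0)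
    (hco : ∀ p ∈ Q, ∀ q ∈ Q, p ≠ q → p.Coprime q) (a : ℕ → ℤ) :
    ∃ s : ℕ, 0 < s ∧ ∀ q ∈ Q, (q : ℤ) ∣ s - a q := by
  obtain ⟨s, hs⟩ := Nat.chineseRemainderOfFinset (fun q => (a q % q).toNat) id Q hpos
    fun p hp q hq hpq => hco p hp q hq hpq
  refine ⟨s + ∏ q ∈ Q, q, Nat.add_pos_right _ (Finset.prod_pos fun q hq =>
    Nat.pos_of_ne_zero (hpos q hq)), fun q hq => ?_⟩
  have h1 : (q : ℤ) ∣ (∏ q ∈ Q, q : ℕ) := Int.natCast_dvd_natCast.2 (Finset.dvd_prod_of_mem _ hq)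
  have h2 : ((a q % q).toNat : ℤ) = a q % q :=
    Int.toNat_of_nonneg (Int.emod_nonneg _ (by exact_mod_cast hpos q hq))
  have h3 : (q : ℤ) ∣ (a q % q).toNat - s := Nat.modEq_iff_dvd.1 (hs q hq)
  have h4 : (q : ℤ) ∣ a q - a q % q := Int.dvd_self_sub_emod
  rw [h2] at h3
  exact ((h1.sub h3).sub h4).trans (Eq.dvd (by push_cast; ring))

/-- A pattern of `η` reappears in `η` at a position in any residue class mod `b ∈ B` for which
its support avoids the multiples of `b`. -/
lemma exists_occurrence_modEq {B : Set ℕ} (hB : IsErdos B) {b : ℕ} (hb : b ∈ B) {L : ℕ}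
    (hL : 0 < L) (p r : ℤ) (hr : ∀ j : ℕ, j < L → eta B (p + j) = true → ¬ (b : ℤ) ∣ r + j) :
    ∃ m : ℤ, (b : ℤ) ∣ m - r ∧ ∀ j : ℕ, j < L → eta B (m + j) = eta B (p + j) := by
  classical
  obtain ⟨hinf, htwo, -, hcop, hsum⟩ := hB
  obtain ⟨K₀, hK₀⟩ := exists_window_not_dvd hsum L hL
  set K := max K₀ (max L b) with hK
  have hinf' : (B \ Set.Iic K).Infinite := hinf.sdiff (Set.finite_Iic K)
  let c : ℕ → ℕ := fun j => (hinf'.natEmbedding _ j : ℕ)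
  have hc : Function.Injective c := fun i j h => (hinf'.natEmbedding _).injective (Subtype.ext h)
  have hcB : ∀ j, c j ∈ B := fun j => (hinf'.natEmbedding _ j).2.1
  have hcK : ∀ j, K < c j := fun j => not_le.1 (hinf'.natEmbedding _ j).2.2
  set Z := (Finset.range L).filter fun j : ℕ => eta B (p + j) = false
  set Q := ((Finset.range (K + 1)).filter fun q => q ∈ B) ∪ Z.image c
  have hQB : ∀ q ∈ Q, q ∈ B := by
    intro q hq
    simp only [Q, Finset.mem_union, Finset.mem_filter, Finset.mem_image] at hq
    rcases hq with hq | ⟨j, -, rfl⟩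
    exacts [hq.2, hcB j]
  have hsmall : ∀ q ∈ B, q ≤ K → q ∈ Q := fun q hq hqK =>
    Finset.mem_union_left _ (Finset.mem_filter.2 ⟨Finset.mem_range.2 (by omega), hq⟩)
  have hcQ : ∀ j ∈ Z, c j ∈ Q := fun j hj =>
    Finset.mem_union_right _ (Finset.mem_image_of_mem c hj)
  have hbK : b ≤ K := by omega
  let a : ℕ → ℤ := fun q =>
    if q = b then r else if q ≤ K then p else -(Function.invFun c q : ℕ)
  have hac : ∀ j, a (c j) = -j := fun j => by
    have h1 := hcK j
    simp only [a, Function.leftInverse_invFun hc j]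
    rw [if_neg (by omega), if_neg (by omega)]
  obtain ⟨s, hs0, hs⟩ := exists_pos_forall_dvd_sub (Q := Q)
    (fun q hq => by have := htwo q (hQB q hq); omega)
    (fun x hx y hy => hcop x (hQB x hx) y (hQB y hy)) a
  set M := ∏ q ∈ Q, q
  obtain ⟨k, hk⟩ := hK₀ M s hs0
  have hm : ∀ q ∈ Q, (q : ℤ) ∣ (s + M * k : ℤ) - a q := fun q hq => by
    have h1 : (q : ℤ) ∣ M := Int.natCast_dvd_natCast.2 (Finset.dvd_prod_of_mem _ hq)
    exact ((hs q hq).add (h1.mul_right k)).trans (Eq.dvd (by ring))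
  have hmb : (b : ℤ) ∣ (s + M * k : ℤ) - r := by simpa [a] using hm b (hsmall b hb hbK)
  refine ⟨s + M * k, hmb, fun j hj => ?_⟩
  cases hj' : eta B (p + j) with
  | false =>
    have hjZ : j ∈ Z := Finset.mem_filter.2 ⟨Finset.mem_range.2 hj, hj'⟩
    have h1 := hm (c j) (hcQ j hjZ)
    rw [hac, sub_neg_eq_add] at h1
    exact Bool.eq_false_iff.2 fun h => eta_eq_true_iff.1 h (c j) (hcB j) h1
  | true =>
    refine eta_eq_true_iff.2 fun q hq hdvd => ?_
    by_cases hqQ : q ∈ Q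
    · have h1 : (q : ℤ) ∣ a q + j := (hdvd.sub (hm q hqQ)).trans (Eq.dvd (by ring))
      by_cases hqb : q = b
      · subst hqb
        exact hr j hj hj' (by simpa [a] using h1)
      by_cases hqK : q ≤ K
      · exact eta_eq_true_iff.1 hj' q hq (by simpa [a, hqb, hqK] using h1)
      · obtain ⟨i, hi, rfl⟩ : ∃ i ∈ Z, c i = q := by
          simp only [Q, Finset.mem_union, Finset.mem_filter, Finset.mem_image,
            Finset.mem_range] at hqQ
          rcases hqQ with h | h
          exacts [absurd h.1 (by omega), h]
        simp only [Z, Finset.mem_filter, Finset.mem_range] at hi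
        rw [hac] at h1
        have h2 : (-(i : ℤ) + j) = 0 := by
          refine Int.eq_zero_of_abs_lt_dvd h1 (abs_lt.2 ?_)
          have := hcK i
          omega
        obtain rfl : i = j := by omega
        simp [hi.2] at hj'
    · have hqK : K < q := not_le.1 fun h => hqQ (hsmall q hq h)
      have hqM : q.Coprime M := Nat.Coprime.prod_right fun x hx =>
        hcop q hq x (hQB x hx) fun h => hqQ (h ▸ hx)
      refine hk q hq (by omega) hqM j hj ?_
      have : (q : ℤ) ∣ ((s + j + M * k : ℕ) : ℤ) :=
        hdvd.trans (Eq.dvd (by push_cast; ring))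
      exact_mod_cast this

lemma shiftPow_mem_Xeta {B : Set ℕ} {x : ℤ → Bool} (hx : x ∈ Xeta B) (t : ℤ) :
    shiftPow t x ∈ Xeta B := by
  have hcont : Continuous (shiftPow t) := continuous_pi fun n => continuous_apply (n + t)
  refine map_mem_closure hcont hx ?_
  rintro _ ⟨u, rfl⟩
  exact ⟨t + u, by funext n; simp [shiftPow, add_assoc]⟩

lemma IsCA.map_shiftPow {B : Set ℕ} {τ : (ℤ → Bool) → (ℤ → Bool)} (hτ : IsCA (Xeta B) τ)
    {x : ℤ → Bool} (hx : x ∈ Xeta B) (t : ℤ) : τ (shiftPow t x) = shiftPow t (τ x) := by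
  have hadd : ∀ (s : ℤ) (y : ℤ → Bool), shift (shiftPow s y) = shiftPow (s + 1) y := by
    intro s y
    funext n
    simp only [shift, shiftPow]
    congr 1
    ring
  induction t with
  | zero =>
    have h0 : ∀ y : ℤ → Bool, shiftPow 0 y = y := fun y => by funext n; simp [shiftPow]
    rw [h0, h0]
  | succ k ih => rw [← hadd, hτ.2.2 _ (shiftPow_mem_Xeta hx _), ih, hadd]
  | pred k ih =>
    have h1 := hτ.2.2 _ (shiftPow_mem_Xeta hx (-k - 1))
    rw [hadd, sub_add_cancel, ih] at h1
    funext n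
    have := congrFun h1 (n - 1)
    simp only [shift, shiftPow] at this ⊢
    rw [sub_add_cancel] at this
    rw [← this]
    congr 1
    ring

/-- On the `B`-free subshift of an Erdős set `B`, every CA is given by a
monotone code modulo a power of the shift: `τ x ≤ S^t x` coordinatewise for some `t`. -/
theorem ca_monotone_mod_shift_erdos (B : Set ℕ) (hB : IsErdos B)
    (τ : (ℤ → Bool) → (ℤ → Bool)) (hτ : IsCA (Xeta B) τ) :
    ∃ t : ℤ, ∀ x ∈ Xeta B, ∀ n : ℤ, τ x n ≤ x (n + t) := by
  obtain ⟨l, hl⟩ := exists_window (X := Xeta B) isClosed_closure.isCompact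
    (f := fun x => τ x 0) ((continuous_apply 0).comp_continuousOn hτ.2.1)
  have hη : eta B ∈ Xeta B := subset_closure ⟨0, by funext n; simp [shiftPow]⟩
  have happly : ∀ x ∈ Xeta B, ∀ n, τ x n = τ (shiftPow n x) 0 := fun x hx n => by
    rw [hτ.map_shiftPow hx, shiftPow, zero_add]
  by_contra! hcon
  have hocc : ∀ t : ℤ, ∃ m : ℤ, τ (eta B) m = true ∧ (|t| ≤ l → eta B (m + t) = false) := by
    intro t
    obtain ⟨x, hx, n, hn⟩ := hcon t
    rw [Bool.lt_iff] at hn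
    have hnx := shiftPow_mem_Xeta hx n
    obtain ⟨m, hm⟩ := exists_shift_eta_eqOn hnx (Finset.Icc (-l) l)
    refine ⟨m, ?_, fun ht => ?_⟩
    · rw [happly _ hη, ← hn.2, happly x hx]
      refine hl _ (shiftPow_eta_mem B m) _ hnx fun i hi hi' => ?_
      exact hm i (Finset.mem_Icc.2 ⟨hi, hi'⟩)
    · rw [add_comm, hm t (Finset.mem_Icc.2 (abs_le.1 ht)), shiftPow, add_comm, hn.1]
  obtain ⟨b, hb, hbl⟩ := hB.1.exists_gt (2 * l + 1)
  have hres : ∀ r : ℤ, ∃ m : ℤ, (b : ℤ) ∣ m - r ∧ τ (eta B) m = true := by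
    intro r
    obtain ⟨m₀, hm₀, hfree⟩ : ∃ m₀ : ℤ, τ (eta B) m₀ = true ∧
        ∀ i : ℤ, |i| ≤ l → eta B (m₀ + i) = true → ¬ (b : ℤ) ∣ r + i := by
      by_cases h : ∃ j : ℤ, |j| ≤ l ∧ (b : ℤ) ∣ r + j
      · obtain ⟨j, hj, hdj⟩ := h
        obtain ⟨m₀, hm₀, hzero⟩ := hocc j
        refine ⟨m₀, hm₀, fun i hi hone hdi => ?_⟩
        have h1 : i - j = 0 := by
          refine Int.eq_zero_of_abs_lt_dvd (m := b)
            ((hdi.sub hdj).trans (Eq.dvd (by ring))) ?_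
          rw [abs_le] at hi hj
          rw [abs_lt]
          omega
        obtain rfl : i = j := by omega
        simp [hzero hi] at hone
      · obtain ⟨m₀, hm₀, -⟩ := hocc 0
        exact ⟨m₀, hm₀, fun i hi _ hdi => h ⟨i, hi, hdi⟩⟩
    obtain ⟨m, hmr, hm⟩ := exists_occurrence_modEq hB hb (L := 2 * l + 1) (by omega)
      (m₀ - l) (r - l) fun j hj hone => by
        have := hfree (j - l) (abs_le.2 (by omega)) (by convert hone using 2; ring)
        exact fun hd => this (hd.trans (Eq.dvd (by ring)))
    refine ⟨m + l, hmr.trans (Eq.dvd (by ring)), ?_⟩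
    rw [happly _ hη, ← hm₀, happly _ hη m₀]
    refine hl _ (shiftPow_eta_mem B _) _ (shiftPow_eta_mem B _) fun i hi hi' => ?_
    have h1 := hm (i + l).toNat (by omega)
    rw [Int.toNat_of_nonneg (by omega)] at h1
    simp only [shiftPow]
    convert h1 using 2 <;> ring
  choose m hmr hm using hres
  obtain ⟨t, ht⟩ := exists_shift_eta_eqOn (hτ.1 hη)
    ((Finset.Ico (0 : ℤ) b).image m)
  have hb0 : (0 : ℤ) < b := by omega
  have hmem : m (-t % b) ∈ (Finset.Ico (0 : ℤ) b).image m :=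
    Finset.mem_image_of_mem _ (Finset.mem_Ico.2
      ⟨Int.emod_nonneg _ hb0.ne', Int.emod_lt_of_pos _ hb0⟩)
  have h1 := ht _ hmem
  rw [hm] at h1
  refine eta_eq_true_iff.1 h1 b hb ?_
  have h2 : (b : ℤ) ∣ -t - -t % b := Int.dvd_self_sub_emod
  exact ((hmr (-t % b)).sub h2).trans (Eq.dvd (by ring))
end

section
/- Assume B is infinite, its elements are pairwise coprime, and 1 ∉ B. Let τ : X_B → X_B be a cellular automaton on the B-admissible subshift, given by a code of radius ℓ. Then there exists t ∈ {−ℓ, …, ℓ} such that τ(x)(n) ≤ x(n+t) for all x ∈ X_B and all n ∈ ℤ (i.e., τ(x) ≤ S^t x coordinatewise). -/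
open Filter Set

theorem shiftPow_mem_XB {B : Set ℕ} {x : ℤ → Bool} (hx : x ∈ XB B) (t : ℤ) :
    shiftPow t x ∈ XB B := by
  intro b hb
  obtain ⟨r, hr⟩ := hx b hb
  refine ⟨r - t, fun a ha hdvd => hr (a + t) ha ?_⟩
  exact (hdvd).trans (dvd_of_eq (by ring))

theorem shiftPow_shiftPow (s t : ℤ) (x : ℤ → Bool) :
    shiftPow s (shiftPow t x) = shiftPow (s + t) x := by
  funext n
  simp only [shiftPow, add_assoc]

theorem shiftPow_zero (x : ℤ → Bool) : shiftPow 0 x = x := by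
  funext n
  simp [shiftPow]

theorem IsCA.shiftPow_natCast {B : Set ℕ} {τ : (ℤ → Bool) → (ℤ → Bool)} (hτ : IsCA (XB B) τ)
    (k : ℕ) {x : ℤ → Bool} (hx : x ∈ XB B) : τ (shiftPow k x) = shiftPow k (τ x) := by
  induction k with
  | zero => simp [shiftPow_zero]
  | succ k ih =>
    have h := hτ.2.2 _ (shiftPow_mem_XB hx (k : ℤ))
    rw [ih] at h
    simp only [shift, shiftPow_shiftPow] at h
    rw [Nat.cast_succ, add_comm (k : ℤ) 1]
    exact h

/-- A cellular automaton on `X_B` commutes with every power of the shift. -/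
theorem IsCA.shiftPow_comm {B : Set ℕ} {τ : (ℤ → Bool) → (ℤ → Bool)} (hτ : IsCA (XB B) τ)
    (t : ℤ) {x : ℤ → Bool} (hx : x ∈ XB B) : τ (shiftPow t x) = shiftPow t (τ x) := by
  obtain ⟨k, rfl | rfl⟩ := t.eq_nat_or_neg
  · exact hτ.shiftPow_natCast k hx
  · have h := hτ.shiftPow_natCast k (shiftPow_mem_XB hx (-(k : ℤ)))
    rw [shiftPow_shiftPow, add_neg_cancel, shiftPow_zero] at h
    rw [h, shiftPow_shiftPow, neg_add_cancel, shiftPow_zero]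

/-- The Chinese remainder theorem for integer residues and finitely many pairwise coprime moduli,
with the solution reduced modulo the product. -/
theorem exists_int_dvd_sub_of_pairwise_coprime (S : Finset ℕ) (hpos : ∀ b ∈ S, b ≠ 0)
    (hcop : ∀ a ∈ S, ∀ b ∈ S, a ≠ b → Nat.Coprime a b) (r : ℕ → ℤ) :
    ∃ k : ℤ, 0 ≤ k ∧ k < ((∏ b ∈ S, b : ℕ) : ℤ) ∧ ∀ b ∈ S, (b : ℤ) ∣ k - r b := by
  have hp : Set.Pairwise (S : Set ℕ) (Function.onFun Nat.Coprime fun b : ℕ => b) :=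
    fun a ha b hb hab => hcop a ha b hb hab
  refine ⟨Nat.chineseRemainderOfFinset (fun b => (r b % (b : ℤ)).toNat) (fun b => b) S hpos hp,
    by positivity, by exact_mod_cast Nat.chineseRemainderOfFinset_lt_prod _ _ hpos hp, ?_⟩
  intro b hb
  have h := (Nat.chineseRemainderOfFinset (fun b => (r b % (b : ℤ)).toNat) (fun b => b) S
    hpos hp).2 b hb
  have hb0 : (b : ℤ) ≠ 0 := by exact_mod_cast hpos b hb
  have h' := (Int.natCast_modEq_iff.2 h).symm
  rw [Int.toNat_of_nonneg (Int.emod_nonneg _ hb0)] at h'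
  exact ((Int.mod_modEq (r b) b).symm.trans h').dvd

/-- A finite set with fewer than `b` elements misses a residue class modulo `b`. -/
theorem exists_residue_disjoint_of_card_lt (F : Finset ℤ) (b : ℕ) (hF : F.card < b) :
    ∃ r : ℤ, ∀ a ∈ F, ¬ ((b : ℤ) ∣ a - r) := by
  have : NeZero b := ⟨by omega⟩
  have hcard : (F.image (fun a : ℤ => (a : ZMod b))).card < (Finset.univ : Finset (ZMod b)).card := by
    rw [Finset.card_univ, ZMod.card]
    exact Finset.card_image_le.trans_lt hF
  obtain ⟨c, -, hc⟩ := Finset.exists_mem_notMem_of_card_lt_card hcard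
  obtain ⟨r, rfl⟩ := ZMod.intCast_surjective c
  refine ⟨r, fun a ha hdvd => hc (Finset.mem_image.2 ⟨a, ha, ?_⟩)⟩
  exact ((ZMod.intCast_eq_intCast_iff_dvd_sub r a b).2 hdvd).symm

open Classical in
/-- The sequence that carries on the window of radius `ℓ` around `n i`, for `i < b`, the central
block of `z i`, and is `0` elsewhere. -/
noncomputable def patchwork (b ℓ : ℕ) (n : ℕ → ℤ) (z : ℕ → ℤ → Bool) : ℤ → Bool :=
  fun m => decide (∃ i < b, |m - n i| ≤ (ℓ : ℤ) ∧ z i (m - n i) = true)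

theorem patchwork_eq_true {b ℓ : ℕ} {n : ℕ → ℤ} {z : ℕ → ℤ → Bool} {m : ℤ} :
    patchwork b ℓ n z m = true ↔ ∃ i < b, |m - n i| ≤ (ℓ : ℤ) ∧ z i (m - n i) = true := by
  simp [patchwork]

/-- If the windows are disjoint, the patchwork agrees with `z i` on the `i`-th window. -/
theorem patchwork_apply_add {b ℓ : ℕ} {n : ℕ → ℤ} {z : ℕ → ℤ → Bool}
    (hsep : ∀ i j, i ≠ j → (2 * ℓ : ℤ) < |n i - n j|) {i : ℕ} (hi : i < b) {k : ℤ}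
    (hk : |k| ≤ (ℓ : ℤ)) : patchwork b ℓ n z (k + n i) = z i k := by
  rw [Bool.eq_iff_iff, patchwork_eq_true]
  constructor
  · rintro ⟨j, -, hj, hz⟩
    by_cases hij : i = j
    · subst hij
      simpa using hz
    · have h1 := hsep i j hij
      have h2 := abs_sub (k + n i - n j) k
      have h3 : k + n i - n j - k = n i - n j := by ring
      rw [h3] at h2
      omega
  · intro hz
    exact ⟨i, hi, by simpa using hk, by simpa using hz⟩

theorem exists_residue_disjoint_supp_patchwork {b ℓ c : ℕ} (n : ℕ → ℤ) (z : ℕ → ℤ → Bool)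
    (hc : b * (2 * ℓ + 1) < c) :
    ∃ r : ℤ, ∀ a ∈ supp (patchwork b ℓ n z), ¬ ((c : ℤ) ∣ a - r) := by
  let F : Finset ℤ := (Finset.range b ×ˢ Finset.Icc (-(ℓ : ℤ)) ℓ).image fun p => p.2 + n p.1
  have hF : F.card < c := by
    refine (Finset.card_image_le.trans_eq ?_).trans_lt hc
    rw [Finset.card_product, Finset.card_range, Int.card_Icc]
    congr 1
    omega
  obtain ⟨r, hr⟩ := exists_residue_disjoint_of_card_lt F c hF
  refine ⟨r, fun a ha => hr a ?_⟩
  obtain ⟨i, hi, hle, -⟩ := patchwork_eq_true.1 ha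
  refine Finset.mem_image.2 ⟨(i, a - n i), ?_, by ring⟩
  rw [Finset.mem_product, Finset.mem_range, Finset.mem_Icc]
  exact ⟨hi, abs_le.1 hle⟩

/-- If each `z i`, for `i < b`, is admissible and vanishes on the residue class of `-i` modulo `b`
inside the window of radius `ℓ`, then the `z i` can be patched together to an admissible sequence
with well separated windows whose centres `n i ≡ i` represent all residues modulo `b`. -/
theorem exists_patchwork_mem_XB {B : Set ℕ} (hBpos : ∀ b ∈ B, 2 ≤ b)
    (hBcop : ∀ a ∈ B, ∀ b ∈ B, a ≠ b → Nat.Coprime a b) {b ℓ : ℕ} (hb : b ∈ B)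
    (hbℓ : 2 * ℓ + 1 < b) {z : ℕ → ℤ → Bool} (hz : ∀ i, z i ∈ XB B)
    (hzero : ∀ i : ℕ, ∀ k : ℤ, |k| ≤ (ℓ : ℤ) → (b : ℤ) ∣ k + i → z i k = false) :
    ∃ n : ℕ → ℤ, (∀ i j, i ≠ j → (2 * ℓ : ℤ) < |n i - n j|) ∧ (∀ i, (b : ℤ) ∣ n i - i) ∧
      patchwork b ℓ n z ∈ XB B := by
  classical
  let S : Finset ℕ := (Finset.range (b * (2 * ℓ + 1) + 1)).filter (· ∈ B)
  have hSB : ∀ c ∈ S, c ∈ B := fun c hc => (Finset.mem_filter.1 hc).2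
  have hSpos : ∀ c ∈ S, c ≠ 0 := fun c hc => by
    have := hBpos c (hSB c hc)
    omega
  have hbS : b ∈ S := by
    refine Finset.mem_filter.2 ⟨Finset.mem_range.2 ?_, hb⟩
    nlinarith
  have hres : ∀ i : ℕ, ∀ c : ℕ, ∃ r : ℤ, c ∈ B → ∀ a ∈ supp (z i), ¬ ((c : ℤ) ∣ a - r) := by
    intro i c
    by_cases hc : c ∈ B
    · obtain ⟨r, hr⟩ := hz i c hc
      exact ⟨r, fun _ => hr⟩
    · exact ⟨0, fun h => absurd h hc⟩
  choose r hr using hres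
  have hcrt := fun i : ℕ => exists_int_dvd_sub_of_pairwise_coprime S hSpos
    (fun a ha c hc => hBcop a (hSB a ha) c (hSB c hc)) (fun c => if c = b then (i : ℤ) else - r i c)
  choose k hk0 hkM hk using hcrt
  set M : ℕ := ∏ c ∈ S, c
  have hbM : b ≤ M := Finset.single_le_prod' (f := fun c : ℕ => c)
    (fun c hc => Nat.one_le_iff_ne_zero.2 (hSpos c hc)) hbS
  have hdvdM : ∀ c ∈ S, (c : ℤ) ∣ M := fun c hc => by
    exact_mod_cast Finset.dvd_prod_of_mem (fun c : ℕ => c) hc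
  have hn : ∀ i, ∀ c ∈ S,
      (c : ℤ) ∣ k i + M * (2 * i) - (if c = b then (i : ℤ) else - r i c) := by
    intro i c hc
    have h := dvd_add (hk i c hc) ((hdvdM c hc).mul_right (2 * (i : ℤ)))
    exact (h).trans (dvd_of_eq (by ring))
  refine ⟨fun i => k i + M * (2 * i), ?_, ?_, ?_⟩
  · intro i j hij
    have hi0 := hk0 i
    have hj0 := hk0 j
    have hiM := hkM i
    have hjM := hkM j
    rw [lt_abs]
    rcases lt_or_gt_of_ne hij with h | h
    · right
      have : (M : ℤ) * (i + 1) ≤ M * j := by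
        exact_mod_cast Nat.mul_le_mul_left M h
      zify at hbℓ hbM
      linarith
    · left
      have : (M : ℤ) * (j + 1) ≤ M * i := by
        exact_mod_cast Nat.mul_le_mul_left M h
      zify at hbℓ hbM
      linarith
  · intro i
    simpa using hn i b hbS
  · intro c hc
    by_cases hlt : b * (2 * ℓ + 1) < c
    · exact exists_residue_disjoint_supp_patchwork _ _ hlt
    have hcS : c ∈ S := Finset.mem_filter.2 ⟨Finset.mem_range.2 (by omega), hc⟩
    refine ⟨0, fun a ha hdvd => ?_⟩
    obtain ⟨i, -, hle, hza⟩ := patchwork_eq_true.1 ha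
    have h := hn i c hcS
    by_cases hcb : c = b
    · subst hcb
      rw [if_pos rfl] at h
      refine Bool.false_ne_true ((hzero i _ hle ?_).symm.trans hza)
      exact (dvd_sub hdvd h).trans (dvd_of_eq (by ring))
    · rw [if_neg hcb] at h
      refine hr i c hc _ hza ?_
      exact (dvd_sub hdvd h).trans (dvd_of_eq (by ring))

/-- on the `B`-admissible subshift (with `B` infinite, pairwise coprime,
`1 ∉ B`), every CA with a code of radius `ℓ` is dominated by a shift `S^t` with `|t| ≤ ℓ`. -/
theorem ca_monotone_on_admissible (B : Set ℕ) (hBinf : B.Infinite)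
    (hBpos : ∀ b ∈ B, 2 ≤ b)
    (hBcop : ∀ a ∈ B, ∀ b ∈ B, a ≠ b → Nat.Coprime a b)
    (τ : (ℤ → Bool) → (ℤ → Bool)) (hτ : IsCA (XB B) τ)
    (ℓ : ℕ) (hcode : HasRadius (XB B) τ ℓ) :
    ∃ t : ℤ, |t| ≤ (ℓ : ℤ) ∧ ∀ x ∈ XB B, ∀ n : ℤ, τ x n ≤ x (n + t) := by
  by_contra! hcon
  have hwit : ∀ t : ℤ, |t| ≤ (ℓ : ℤ) → ∃ y ∈ XB B, τ y 0 = true ∧ y t = false := by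
    intro t ht
    obtain ⟨x, hx, n, hlt⟩ := hcon t ht
    obtain ⟨hxf, hxt⟩ := Bool.lt_iff.1 hlt
    refine ⟨shiftPow n x, shiftPow_mem_XB hx n, ?_, ?_⟩
    · simpa [hτ.shiftPow_comm n hx, shiftPow] using hxt
    · rwa [shiftPow, add_comm]
  obtain ⟨b, hb, hbℓ⟩ := hBinf.exists_gt (2 * ℓ + 1)
  have hblock : ∀ i : ℕ, ∃ y ∈ XB B, τ y 0 = true ∧
      ∀ k : ℤ, |k| ≤ (ℓ : ℤ) → (b : ℤ) ∣ k + i → y k = false := by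
    intro i
    by_cases hex : ∃ t : ℤ, |t| ≤ (ℓ : ℤ) ∧ (b : ℤ) ∣ t + i
    · obtain ⟨t, ht, hti⟩ := hex
      obtain ⟨y, hy, hτy, hyt⟩ := hwit t ht
      refine ⟨y, hy, hτy, fun k hk hki => ?_⟩
      have hdvd : (b : ℤ) ∣ k - t := by
        exact (dvd_sub hki hti).trans (dvd_of_eq (by ring))
      have hkt : k - t = 0 := by
        refine Int.eq_zero_of_abs_lt_dvd hdvd ?_
        have := abs_sub k t
        omega
      rw [sub_eq_zero.1 hkt, hyt]
    · obtain ⟨y, hy, hτy, -⟩ := hwit 0 (by simp)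
      exact ⟨y, hy, hτy, fun k hk hki => absurd ⟨k, hk, hki⟩ hex⟩
  choose z hz hτz hzero using hblock
  obtain ⟨n, hsep, hni, hx⟩ := exists_patchwork_mem_XB hBpos hBcop hb hbℓ hz hzero
  have hτx : ∀ i < b, τ (patchwork b ℓ n z) (n i) = true := by
    intro i hi
    have h := hcode _ (shiftPow_mem_XB hx (n i)) _ (hz i) 0 fun k hk₁ hk₂ =>
      patchwork_apply_add hsep hi (abs_le.2 ⟨by omega, by omega⟩)
    rw [hτ.shiftPow_comm _ hx, hτz i] at h
    simpa [shiftPow] using h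
  obtain ⟨r, hr⟩ := hτ.1 hx b hb
  have hb0 : (b : ℤ) ≠ 0 := by omega
  have hi0 := Int.emod_nonneg r hb0
  have hib := Int.emod_lt_of_pos r (show (0 : ℤ) < b by omega)
  refine hr _ (hτx (r % b).toNat (by omega)) ?_
  have h1 := hni (r % b).toNat
  rw [Int.toNat_of_nonneg hi0] at h1
  have h2 : (b : ℤ) ∣ r % b - r := (Int.mod_modEq r b).symm.dvd
  exact (dvd_add h1 h2).trans (dvd_of_eq (by ring))
end
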